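/- (Trace bounds via the cost.) For every K ∈ 𝕂: (i) C(K) = ∑_{i=1}^N tr((Q_i + K_iᵀ R_i K_i) 𝐗^K_i); (ii) max_i ‖P^K_i‖ ≤ ∑_{i=1}^N tr(P^K_i) ≤ C(K)/μ; and (iii) ∑_{i=1}^N tr(𝐗^K_i) ≤ C(K)/Λ_min(Q). -/

import Mathlib

open Matrix Filter
open scoped Kronecker Topology

namespace MJLS

noncomputable section

attribute [local instance] Classical.propDecidable

/-- Closed-loop matrices `Γ i = A i - B i * K i`. -/
def Gam {d k N : ℕ} (A : Fin N → Matrix (Fin d) (Fin d) ℝ)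
    (B : Fin N → Matrix (Fin d) (Fin k) ℝ)
    (K : Fin N → Matrix (Fin k) (Fin d) ℝ) : Fin N → Matrix (Fin d) (Fin d) ℝ :=
  fun i => A i - B i * K i

/-- The operator `E_i(V) = ∑ j, p i j • V j`. -/
def opE {d N : ℕ} (Pr : Matrix (Fin N) (Fin N) ℝ)
    (V : Fin N → Matrix (Fin d) (Fin d) ℝ) : Fin N → Matrix (Fin d) (Fin d) ℝ :=
  fun i => ∑ j, Pr i j • V j

/-- The matrix `𝒜 = diag(Γᵀ ⊗ Γᵀ) (P ⊗ I)`. -/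
def calA {d N : ℕ} (Pr : Matrix (Fin N) (Fin N) ℝ)
    (Γ : Fin N → Matrix (Fin d) (Fin d) ℝ) :
    Matrix (Fin N × Fin d × Fin d) (Fin N × Fin d × Fin d) ℝ :=
  (Matrix.reindex (Equiv.prodComm (Fin d × Fin d) (Fin N))
      (Equiv.prodComm (Fin d × Fin d) (Fin N))
      (Matrix.blockDiagonal fun i => (Γ i)ᵀ ⊗ₖ (Γ i)ᵀ)) *
    (Pr ⊗ₖ (1 : Matrix (Fin d × Fin d) (Fin d × Fin d) ℝ))

/-- `K` is mean-square stabilizing: the spectral radius of `𝒜` is less than `1`. -/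
def MSS {d k N : ℕ} (Pr : Matrix (Fin N) (Fin N) ℝ)
    (A : Fin N → Matrix (Fin d) (Fin d) ℝ) (B : Fin N → Matrix (Fin d) (Fin k) ℝ)
    (K : Fin N → Matrix (Fin k) (Fin d) ℝ) : Prop :=
  spectralRadius ℂ ((calA Pr (Gam A B K)).map (algebraMap ℝ ℂ)) < 1

/-- `P` solves the coupled Lyapunov equations for the policy `K`. -/
def IsLyap {d k N : ℕ} (Pr : Matrix (Fin N) (Fin N) ℝ)
    (A : Fin N → Matrix (Fin d) (Fin d) ℝ) (B : Fin N → Matrix (Fin d) (Fin k) ℝ)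
    (Q : Fin N → Matrix (Fin d) (Fin d) ℝ) (R : Fin N → Matrix (Fin k) (Fin k) ℝ)
    (K : Fin N → Matrix (Fin k) (Fin d) ℝ)
    (P : Fin N → Matrix (Fin d) (Fin d) ℝ) : Prop :=
  ∀ i, P i = Q i + (K i)ᵀ * R i * K i + (Gam A B K i)ᵀ * opE Pr P i * Gam A B K i

/-- `P^K`, the (for mean-square stabilizing `K`, unique) solution of the coupled
Lyapunov equations. -/
def PK {d k N : ℕ} (Pr : Matrix (Fin N) (Fin N) ℝ)
    (A : Fin N → Matrix (Fin d) (Fin d) ℝ) (B : Fin N → Matrix (Fin d) (Fin k) ℝ)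
    (Q : Fin N → Matrix (Fin d) (Fin d) ℝ) (R : Fin N → Matrix (Fin k) (Fin k) ℝ)
    (K : Fin N → Matrix (Fin k) (Fin d) ℝ) : Fin N → Matrix (Fin d) (Fin d) ℝ :=
  if h : ∃ P, IsLyap Pr A B Q R K P then h.choose else 0

/-- The LQR cost `C(K) = ∑ i, π i * tr(P^K_i Sg)`. -/
def cost {d k N : ℕ} (Pr : Matrix (Fin N) (Fin N) ℝ)
    (A : Fin N → Matrix (Fin d) (Fin d) ℝ) (B : Fin N → Matrix (Fin d) (Fin k) ℝ)
    (Q : Fin N → Matrix (Fin d) (Fin d) ℝ) (R : Fin N → Matrix (Fin k) (Fin k) ℝ)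
    (piv : Fin N → ℝ) (Sg : Matrix (Fin d) (Fin d) ℝ)
    (K : Fin N → Matrix (Fin k) (Fin d) ℝ) : ℝ :=
  ∑ i, piv i * (PK Pr A B Q R K i * Sg).trace

/-- The operator `T_j(V) = ∑ i, p i j • (Γ i * V i * Γ iᵀ)`. -/
def opT {d N : ℕ} (Pr : Matrix (Fin N) (Fin N) ℝ)
    (Γ : Fin N → Matrix (Fin d) (Fin d) ℝ)
    (V : Fin N → Matrix (Fin d) (Fin d) ℝ) : Fin N → Matrix (Fin d) (Fin d) ℝ :=
  fun j => ∑ i, Pr i j • (Γ i * V i * (Γ i)ᵀ)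

/-- `𝐗^K = ∑_{t=0}^∞ T^t(X(0))` with `X_i(0) = π i • Sg`. -/
def XK {d N : ℕ} (Pr : Matrix (Fin N) (Fin N) ℝ) (piv : Fin N → ℝ)
    (Sg : Matrix (Fin d) (Fin d) ℝ) (Γ : Fin N → Matrix (Fin d) (Fin d) ℝ) :
    Fin N → Matrix (Fin d) (Fin d) ℝ :=
  ∑' t : ℕ, (opT Pr Γ)^[t] (fun i => piv i • Sg)

/-- `L^K_i = (R i + B iᵀ E_i(P^K) B i) K i - B iᵀ E_i(P^K) A i`. -/
def LK {d k N : ℕ} (Pr : Matrix (Fin N) (Fin N) ℝ)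
    (A : Fin N → Matrix (Fin d) (Fin d) ℝ) (B : Fin N → Matrix (Fin d) (Fin k) ℝ)
    (Q : Fin N → Matrix (Fin d) (Fin d) ℝ) (R : Fin N → Matrix (Fin k) (Fin k) ℝ)
    (K : Fin N → Matrix (Fin k) (Fin d) ℝ) : Fin N → Matrix (Fin k) (Fin d) ℝ :=
  fun i => (R i + (B i)ᵀ * opE Pr (PK Pr A B Q R K) i * B i) * K i
    - (B i)ᵀ * opE Pr (PK Pr A B Q R K) i * A i

/-- The operator `L_i(V) = Γ iᵀ E_i(V) Γ i`. -/
def opL {d N : ℕ} (Pr : Matrix (Fin N) (Fin N) ℝ)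
    (Γ : Fin N → Matrix (Fin d) (Fin d) ℝ)
    (V : Fin N → Matrix (Fin d) (Fin d) ℝ) : Fin N → Matrix (Fin d) (Fin d) ℝ :=
  fun i => (Γ i)ᵀ * opE Pr V i * Γ i

/-- `(P^K)'[E] = ∑_{t=0}^∞ L^t(Eᵀ L^K + (L^K)ᵀ E)`. -/
def PKd {d k N : ℕ} (Pr : Matrix (Fin N) (Fin N) ℝ)
    (Γ : Fin N → Matrix (Fin d) (Fin d) ℝ)
    (Lk E : Fin N → Matrix (Fin k) (Fin d) ℝ) : Fin N → Matrix (Fin d) (Fin d) ℝ :=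
  ∑' t : ℕ, (opL Pr Γ)^[t] (fun i => (E i)ᵀ * Lk i + (Lk i)ᵀ * E i)

/-- `‖V‖₂² = ∑ i, tr(V iᵀ V i)`. -/
def norm2sq {a b N : ℕ} (V : Fin N → Matrix (Fin a) (Fin b) ℝ) : ℝ :=
  ∑ i, ((V i)ᵀ * V i).trace

/-- The inner product `⟨V, S⟩ = ∑ i, tr(V iᵀ S i)`. -/
def ip {a b N : ℕ} (V S : Fin N → Matrix (Fin a) (Fin b) ℝ) : ℝ :=
  ∑ i, ((V i)ᵀ * S i).trace

/-- The spectral norm (maximal singular value) of a matrix. -/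
def specNorm {a b : ℕ} (M : Matrix (Fin a) (Fin b) ℝ) : ℝ :=
  ⨆ x : {x : EuclideanSpace ℝ (Fin b) // ‖x‖ ≤ 1}, ‖Matrix.toEuclideanLin M x.1‖

/-- The minimal singular value of a square matrix. -/
def sigmaMin {a : ℕ} (M : Matrix (Fin a) (Fin a) ℝ) : ℝ :=
  ⨅ x : {x : EuclideanSpace ℝ (Fin a) // ‖x‖ = 1}, ‖Matrix.toEuclideanLin M x.1‖

/-- `‖V‖_max = max_i ‖V i‖` (spectral norms). -/
def maxNorm {a b N : ℕ} (V : Fin N → Matrix (Fin a) (Fin b) ℝ) : ℝ :=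
  ⨆ i, specNorm (V i)

/-- `Λ_min(V) = min_i σ_min(V i)`. -/
def lamMin {a N : ℕ} (V : Fin N → Matrix (Fin a) (Fin a) ℝ) : ℝ :=
  ⨅ i, sigmaMin (V i)

/-- `μ = (min_i π i) · σ_min(Sg)`. -/
def mu {d N : ℕ} (piv : Fin N → ℝ) (Sg : Matrix (Fin d) (Fin d) ℝ) : ℝ :=
  (⨅ i, piv i) * sigmaMin Sg

/-- `ξ(α) = (1/Λ_min(Q))·((1 + ‖B‖²_max)·α/μ + ‖R‖_max) − 1`. -/
def xi {d k N : ℕ} (B : Fin N → Matrix (Fin d) (Fin k) ℝ)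
    (R : Fin N → Matrix (Fin k) (Fin k) ℝ) (Q : Fin N → Matrix (Fin d) (Fin d) ℝ)
    (piv : Fin N → ℝ) (Sg : Matrix (Fin d) (Fin d) ℝ) (α : ℝ) : ℝ :=
  (1 / lamMin Q) * ((1 + maxNorm B ^ 2) * α / mu piv Sg + maxNorm R) - 1

/-- The smoothness constant
`L(α) = 2·(‖R‖_max + ‖B‖²_max·(1 + 2ξ(α)/‖B‖_max)·α/μ)·α/Λ_min(Q)`. -/
def Lsm {d k N : ℕ} (B : Fin N → Matrix (Fin d) (Fin k) ℝ)
    (R : Fin N → Matrix (Fin k) (Fin k) ℝ) (Q : Fin N → Matrix (Fin d) (Fin d) ℝ)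
    (piv : Fin N → ℝ) (Sg : Matrix (Fin d) (Fin d) ℝ) (α : ℝ) : ℝ :=
  2 * (maxNorm R + maxNorm B ^ 2 * (1 + 2 * xi B R Q piv Sg α / maxNorm B)
      * α / mu piv Sg) * α / lamMin Q

end

/-! ### Helper lemmas -/

section helpers

attribute [local instance] Matrix.linftyOpNormedRing Matrix.linftyOpNormedAlgebra in
theorem summable_norm_pow {n : Type*} [Fintype n] [DecidableEq n] (M : Matrix n n ℂ)
    (h : spectralRadius ℂ M < 1) : Summable fun t : ℕ => ‖M ^ t‖ := by
  obtain ⟨r, hr1, hr2⟩ := exists_between h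
  have hg := spectrum.pow_nnnorm_pow_one_div_tendsto_nhds_spectralRadius M
  have hev := hg.eventually (gt_mem_nhds hr1)
  lift r to NNReal using (ne_top_of_lt hr2)
  have hr2' : (r : ℝ) < 1 := by exact_mod_cast hr2
  refine Summable.of_norm_bounded_eventually_nat
    (g := fun t => (r : ℝ) ^ t) (summable_geometric_of_lt_one r.2 hr2') ?_
  filter_upwards [hev, eventually_gt_atTop 0] with t ht ht0
  rw [norm_norm]
  have h1 : ((‖M ^ t‖₊ : ENNReal)) ≤ (r : ENNReal) ^ t := by
    have h2 := ENNReal.rpow_le_rpow ht.le (z := (t : ℝ)) (by positivity)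
    rw [← ENNReal.rpow_mul, one_div, inv_mul_cancel₀ (by positivity), ENNReal.rpow_one,
      ENNReal.rpow_natCast] at h2
    exact h2
  exact_mod_cast h1

attribute [local instance] Matrix.linftyOpNormedRing Matrix.linftyOpNormedAlgebra in
theorem summable_entry_pow {n : Type*} [Fintype n] [DecidableEq n] (M : Matrix n n ℝ)
    (h : spectralRadius ℂ (M.map (algebraMap ℝ ℂ)) < 1) (p q : n) :
    Summable fun t : ℕ => (M ^ t) p q := by
  refine Summable.of_norm_bounded (summable_norm_pow _ h) fun t => ?_
  have h1 : (M.map (algebraMap ℝ ℂ)) ^ t = (M ^ t).map (algebraMap ℝ ℂ) := by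
    exact (map_pow (RingHom.mapMatrix (algebraMap ℝ ℂ)) M t).symm
  rw [h1]
  have h2 : ‖(M ^ t) p q‖₊ ≤ ‖(M ^ t).map (algebraMap ℝ ℂ)‖₊ := by
    rw [Matrix.linfty_opNNNorm_def]
    refine le_trans ?_ (Finset.le_sup (Finset.mem_univ p))
    refine le_trans ?_ (Finset.single_le_sum (fun _ _ => zero_le) (Finset.mem_univ q))
    simp
  exact_mod_cast h2

/-- Vectorization of a tuple of matrices. -/
def tvec {d N : ℕ} (V : Fin N → Matrix (Fin d) (Fin d) ℝ) : Fin N × Fin d × Fin d → ℝ :=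
  fun q => V q.1 q.2.1 q.2.2

theorem calA_apply {d N : ℕ} (Pr : Matrix (Fin N) (Fin N) ℝ)
    (Γ : Fin N → Matrix (Fin d) (Fin d) ℝ) (i j : Fin N) (a b c e : Fin d) :
    calA Pr Γ (i, a, b) (j, c, e) = Γ i c a * Γ i e b * Pr i j := by
  simp [calA, Matrix.mul_apply, Fintype.sum_prod_type, Matrix.blockDiagonal_apply,
    Matrix.one_apply, Prod.ext_iff, ← ite_and]
  rw [Fintype.sum_eq_single i, Fintype.sum_eq_single c, Fintype.sum_eq_single e]
  · simp
  · intro x hx; simp [hx]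
  · intro x hx; simp [hx]
  · intro x hx; simp [hx.symm]

theorem tvec_opL {d N : ℕ} (Pr : Matrix (Fin N) (Fin N) ℝ)
    (Γ : Fin N → Matrix (Fin d) (Fin d) ℝ) (V : Fin N → Matrix (Fin d) (Fin d) ℝ) :
    tvec (opL Pr Γ V) = calA Pr Γ *ᵥ tvec V := by
  ext ⟨i, a, b⟩
  simp only [tvec, opL, opE, Matrix.mulVec, dotProduct, Fintype.sum_prod_type, calA_apply,
    Matrix.mul_apply, Matrix.sum_apply, Matrix.smul_apply, Matrix.transpose_apply, smul_eq_mul,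
    Finset.sum_mul, Finset.mul_sum]
  rw [Finset.sum_comm]
  refine Finset.sum_congr rfl fun j _ => ?_
  rw [Finset.sum_comm]
  refine Finset.sum_congr rfl fun c _ => ?_
  refine Finset.sum_congr rfl fun e _ => ?_
  ring

theorem tvec_opT {d N : ℕ} (Pr : Matrix (Fin N) (Fin N) ℝ)
    (Γ : Fin N → Matrix (Fin d) (Fin d) ℝ) (V : Fin N → Matrix (Fin d) (Fin d) ℝ) :
    tvec (opT Pr Γ V) = (calA Pr Γ)ᵀ *ᵥ tvec V := by
  ext ⟨j, c, e⟩
  simp only [tvec, opT, Matrix.mulVec, dotProduct, Fintype.sum_prod_type, calA_apply,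
    Matrix.mul_apply, Matrix.sum_apply, Matrix.smul_apply, Matrix.transpose_apply, smul_eq_mul,
    Finset.sum_mul, Finset.mul_sum]
  refine Finset.sum_congr rfl fun i _ => ?_
  rw [Finset.sum_comm]
  refine Finset.sum_congr rfl fun c _ => Finset.sum_congr rfl fun e _ => ?_
  ring

theorem tvec_iterate {d N : ℕ} (M : Matrix (Fin N × Fin d × Fin d) (Fin N × Fin d × Fin d) ℝ)
    (F : (Fin N → Matrix (Fin d) (Fin d) ℝ) → (Fin N → Matrix (Fin d) (Fin d) ℝ))
    (hF : ∀ V, tvec (F V) = M *ᵥ tvec V) (V : Fin N → Matrix (Fin d) (Fin d) ℝ) (t : ℕ) :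
    tvec (F^[t] V) = (M ^ t) *ᵥ tvec V := by
  induction t with
  | zero => simp
  | succ t ih => rw [Function.iterate_succ_apply', hF, ih, Matrix.mulVec_mulVec, pow_succ']

theorem summable_iterate {d N : ℕ} (M : Matrix (Fin N × Fin d × Fin d) (Fin N × Fin d × Fin d) ℝ)
    (hM : ∀ p q, Summable fun t : ℕ => (M ^ t) p q)
    (F : (Fin N → Matrix (Fin d) (Fin d) ℝ) → (Fin N → Matrix (Fin d) (Fin d) ℝ))
    (hF : ∀ V, tvec (F V) = M *ᵥ tvec V) (V : Fin N → Matrix (Fin d) (Fin d) ℝ) :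
    Summable fun t : ℕ => F^[t] V := by
  refine Pi.summable.2 fun i => Pi.summable.2 fun a => Pi.summable.2 fun b => ?_
  have h : ∀ t, (F^[t] V) i a b = ∑ q, (M ^ t) (i, a, b) q * tvec V q := fun t =>
    congrFun (tvec_iterate M F hF V t) (i, a, b)
  simp only [h]
  exact summable_sum fun q _ => (hM _ q).mul_right _

/-- Pairing of tuples. -/
def pair {d N : ℕ} (U V : Fin N → Matrix (Fin d) (Fin d) ℝ) : ℝ := ∑ i, (U i * V i).trace

theorem pair_opL {d N : ℕ} (Pr : Matrix (Fin N) (Fin N) ℝ)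
    (Γ : Fin N → Matrix (Fin d) (Fin d) ℝ) (U V : Fin N → Matrix (Fin d) (Fin d) ℝ) :
    pair (opL Pr Γ U) V = pair U (opT Pr Γ V) := by
  simp only [pair, opL, opT, opE, Finset.mul_sum, Finset.sum_mul, Matrix.trace_sum,
    Matrix.mul_smul, Matrix.smul_mul, Matrix.trace_smul]
  rw [Finset.sum_comm]
  refine Finset.sum_congr rfl fun j _ => Finset.sum_congr rfl fun i _ => ?_
  congr 1
  rw [Matrix.mul_assoc, Matrix.mul_assoc, Matrix.trace_mul_comm, Matrix.mul_assoc, Matrix.mul_assoc]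

theorem pair_iterate {d N : ℕ} (Pr : Matrix (Fin N) (Fin N) ℝ)
    (Γ : Fin N → Matrix (Fin d) (Fin d) ℝ) (t : ℕ) (U V : Fin N → Matrix (Fin d) (Fin d) ℝ) :
    pair ((opL Pr Γ)^[t] U) V = pair U ((opT Pr Γ)^[t] V) := by
  induction t generalizing V with
  | zero => rfl
  | succ t ih =>
    rw [Function.iterate_succ_apply', pair_opL, ih, ← Function.iterate_succ_apply]

theorem continuous_pair_left {d N : ℕ} (V : Fin N → Matrix (Fin d) (Fin d) ℝ) :
    Continuous fun U => pair U V := by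
  unfold pair; fun_prop

theorem continuous_pair_right {d N : ℕ} (U : Fin N → Matrix (Fin d) (Fin d) ℝ) :
    Continuous fun V => pair U V := by
  unfold pair; fun_prop

/-- Pairing as additive map on the left. -/
def pairL {d N : ℕ} (V : Fin N → Matrix (Fin d) (Fin d) ℝ) :
    (Fin N → Matrix (Fin d) (Fin d) ℝ) →+ ℝ where
  toFun U := pair U V
  map_zero' := by simp [pair]
  map_add' := by intro x y; simp [pair, Matrix.add_mul, Finset.sum_add_distrib]

/-- Pairing as additive map on the right. -/
def pairR {d N : ℕ} (U : Fin N → Matrix (Fin d) (Fin d) ℝ) :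
    (Fin N → Matrix (Fin d) (Fin d) ℝ) →+ ℝ where
  toFun V := pair U V
  map_zero' := by simp [pair]
  map_add' := by intro x y; simp [pair, Matrix.mul_add, Finset.sum_add_distrib]

theorem opL_add {d N : ℕ} (Pr : Matrix (Fin N) (Fin N) ℝ)
    (Γ : Fin N → Matrix (Fin d) (Fin d) ℝ) (U V : Fin N → Matrix (Fin d) (Fin d) ℝ) :
    opL Pr Γ (U + V) = opL Pr Γ U + opL Pr Γ V := by
  ext1 i
  simp [opL, opE, Finset.sum_add_distrib, Matrix.mul_add, Matrix.add_mul]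

/-- `opL` as an additive map. -/
def opLhom {d N : ℕ} (Pr : Matrix (Fin N) (Fin N) ℝ)
    (Γ : Fin N → Matrix (Fin d) (Fin d) ℝ) :
    (Fin N → Matrix (Fin d) (Fin d) ℝ) →+ (Fin N → Matrix (Fin d) (Fin d) ℝ) where
  toFun := opL Pr Γ
  map_zero' := by ext1 i; simp [opL, opE]
  map_add' := opL_add Pr Γ

theorem continuous_opL {d N : ℕ} (Pr : Matrix (Fin N) (Fin N) ℝ)
    (Γ : Fin N → Matrix (Fin d) (Fin d) ℝ) : Continuous (opL Pr Γ) := by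
  unfold opL opE; fun_prop

/-- A solution of `P = W + L P` is the sum of the series. -/
theorem hasSum_of_fix {d N : ℕ} (Pr : Matrix (Fin N) (Fin N) ℝ)
    (Γ : Fin N → Matrix (Fin d) (Fin d) ℝ)
    (hs : ∀ V, Summable fun t : ℕ => (opL Pr Γ)^[t] V)
    (W P : Fin N → Matrix (Fin d) (Fin d) ℝ) (hP : P = W + opL Pr Γ P) :
    HasSum (fun t : ℕ => (opL Pr Γ)^[t] W) P := by
  have hfin : ∀ t : ℕ, ∑ s ∈ Finset.range t, (opL Pr Γ)^[s] W = P - (opL Pr Γ)^[t] P := by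
    intro t
    induction t with
    | zero => simp
    | succ t ih =>
      have h1 : (opL Pr Γ)^[t] P = (opL Pr Γ)^[t] W + (opL Pr Γ)^[t + 1] P := by
        rw [Function.iterate_succ_apply]
        have h2 := iterate_map_add (opLhom Pr Γ) t W (opL Pr Γ P)
        conv_lhs => rw [hP]
        exact h2
      rw [Finset.sum_range_succ, ih, h1]
      abel
  have h0 := (hs P).tendsto_atTop_zero
  have h3 : Tendsto (fun t => P - (opL Pr Γ)^[t] P) atTop (𝓝 (P - 0)) :=
    tendsto_const_nhds.sub h0
  have h4 := (hs W).hasSum.tendsto_sum_nat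
  simp only [hfin] at h4
  have h5 := tendsto_nhds_unique h4 h3
  rw [sub_zero] at h5
  rw [← h5]
  exact (hs W).hasSum

theorem exists_fix {d N : ℕ} (Pr : Matrix (Fin N) (Fin N) ℝ)
    (Γ : Fin N → Matrix (Fin d) (Fin d) ℝ)
    (hs : ∀ V, Summable fun t : ℕ => (opL Pr Γ)^[t] V)
    (W : Fin N → Matrix (Fin d) (Fin d) ℝ) : ∃ P, P = W + opL Pr Γ P := by
  refine ⟨∑' t : ℕ, (opL Pr Γ)^[t] W, ?_⟩
  have h1 := ((hs W).hasSum.map (opLhom Pr Γ) (continuous_opL Pr Γ)).tsum_eq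
  rw [(hs W).tsum_eq_zero_add]
  simp only [Function.iterate_succ_apply', Function.iterate_zero, id]
  congr 1
  have h2 : (∑' t : ℕ, (opL Pr Γ)^[t] W) = W + ∑' t : ℕ, opL Pr Γ ((opL Pr Γ)^[t] W) := by
    rw [(hs W).tsum_eq_zero_add]
    simp only [Function.iterate_succ_apply', Function.iterate_zero, id]
  rw [← h2]
  exact h1

theorem isClosed_psd {d : ℕ} : IsClosed {M : Matrix (Fin d) (Fin d) ℝ | M.PosSemidef} := by
  simp only [Matrix.posSemidef_iff_dotProduct_mulVec, Set.ofPred_and, Set.ofPred_forall]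
  refine IsClosed.inter ?_ (isClosed_iInter fun x => ?_)
  · exact isClosed_eq (by fun_prop) continuous_id
  · exact isClosed_le continuous_const (by fun_prop)

theorem psd_hasSum {d N : ℕ} (f : ℕ → Fin N → Matrix (Fin d) (Fin d) ℝ)
    (X : Fin N → Matrix (Fin d) (Fin d) ℝ) (hf : HasSum f X)
    (h : ∀ t i, (f t i).PosSemidef) (i : Fin N) : (X i).PosSemidef := by
  have h1 := Pi.hasSum.1 hf i
  refine isClosed_psd.mem_of_tendsto h1 (Eventually.of_forall fun s => ?_)
  exact Matrix.posSemidef_sum s fun t _ => h t i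

theorem psd_opL {d N : ℕ} (Pr : Matrix (Fin N) (Fin N) ℝ) (hPr : ∀ i j, 0 ≤ Pr i j)
    (Γ : Fin N → Matrix (Fin d) (Fin d) ℝ) (V : Fin N → Matrix (Fin d) (Fin d) ℝ)
    (hV : ∀ i, (V i).PosSemidef) (i : Fin N) : (opL Pr Γ V i).PosSemidef := by
  have h1 : (opE Pr V i).PosSemidef :=
    Matrix.posSemidef_sum _ fun j _ => (hV j).smul (hPr i j)
  have := h1.conjTranspose_mul_mul_same (Γ i)
  simpa [opL] using this

theorem psd_opT {d N : ℕ} (Pr : Matrix (Fin N) (Fin N) ℝ) (hPr : ∀ i j, 0 ≤ Pr i j)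
    (Γ : Fin N → Matrix (Fin d) (Fin d) ℝ) (V : Fin N → Matrix (Fin d) (Fin d) ℝ)
    (hV : ∀ i, (V i).PosSemidef) (j : Fin N) : (opT Pr Γ V j).PosSemidef := by
  refine Matrix.posSemidef_sum _ fun i _ => ?_
  have := ((hV i).mul_mul_conjTranspose_same (Γ i)).smul (hPr i j)
  simpa using this

theorem psd_iterate {d N : ℕ}
    (F : (Fin N → Matrix (Fin d) (Fin d) ℝ) → (Fin N → Matrix (Fin d) (Fin d) ℝ))
    (hF : ∀ V, (∀ i, (V i).PosSemidef) → ∀ i, (F V i).PosSemidef)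
    (V : Fin N → Matrix (Fin d) (Fin d) ℝ) (hV : ∀ i, (V i).PosSemidef) (t : ℕ) :
    ∀ i, ((F^[t] V) i).PosSemidef := by
  induction t with
  | zero => exact hV
  | succ t ih => rw [Function.iterate_succ_apply']; exact hF _ ih

theorem sigmaMin_le {a : ℕ} (M : Matrix (Fin a) (Fin a) ℝ) (x : EuclideanSpace ℝ (Fin a))
    (hx : ‖x‖ = 1) : sigmaMin M ≤ ‖Matrix.toEuclideanLin M x‖ :=
  ciInf_le (f := fun x : {x : EuclideanSpace ℝ (Fin a) // ‖x‖ = 1} =>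
    ‖Matrix.toEuclideanLin M x.1‖) ⟨0, by rintro _ ⟨y, rfl⟩; positivity⟩ ⟨x, hx⟩

theorem sigmaMin_pos {a : ℕ} (ha : 0 < a) (M : Matrix (Fin a) (Fin a) ℝ) (hM : M.PosDef) :
    0 < sigmaMin M := by
  have hinj : LinearMap.ker (Matrix.toEuclideanLin M) = ⊥ := by
    rw [LinearMap.ker_eq_bot']
    intro x hx
    by_contra hne
    have h1 := hM.dotProduct_mulVec_pos (x := x.ofLp) (by simpa using hne)
    have h2 : M *ᵥ x.ofLp = 0 := by
      have := congrArg WithLp.ofLp hx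
      simpa [Matrix.ofLp_toLpLin] using this
    rw [h2] at h1
    simp at h1
  obtain ⟨c, hc, hanti⟩ := LinearMap.exists_antilipschitzWith _ hinj
  have : Nonempty {x : EuclideanSpace ℝ (Fin a) // ‖x‖ = 1} :=
    ⟨⟨EuclideanSpace.single ⟨0, ha⟩ 1, by simp⟩⟩
  have hc' : (0 : ℝ) < c := by exact_mod_cast hc
  refine lt_of_lt_of_le (inv_pos.2 hc') (le_ciInf fun x => ?_)
  have h1 := hanti.le_mul_dist x.1 0
  simp only [map_zero, dist_zero_right, x.2] at h1
  rw [inv_le_iff_one_le_mul₀' hc']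
  exact h1

theorem psd_sub_sigmaMin {a : ℕ} (S : Matrix (Fin a) (Fin a) ℝ) (hS : S.PosSemidef) :
    (S - sigmaMin S • (1 : Matrix (Fin a) (Fin a) ℝ)).PosSemidef := by
  have hH : (S - sigmaMin S • (1 : Matrix (Fin a) (Fin a) ℝ)).IsHermitian := by
    refine hS.isHermitian.sub ?_
    simp [Matrix.IsHermitian, Matrix.conjTranspose_smul]
  rw [hH.posSemidef_iff_eigenvalues_nonneg]
  intro i
  have h1 := hH.mulVec_eigenvectorBasis i
  set v := hH.eigenvectorBasis i with hv
  set η := hH.eigenvalues i with hη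
  have hn : ‖v‖ = 1 := hH.eigenvectorBasis.orthonormal.1 i
  have h2 : S *ᵥ v.ofLp = (η + sigmaMin S) • v.ofLp := by
    rw [Matrix.sub_mulVec, Matrix.smul_mulVec, Matrix.one_mulVec, sub_eq_iff_eq_add] at h1
    rw [h1, add_smul]
  have h3 : 0 ≤ η + sigmaMin S := by
    have h4 := hS.dotProduct_mulVec_nonneg v.ofLp
    rw [h2, dotProduct_smul] at h4
    have h5 : star v.ofLp ⬝ᵥ v.ofLp = 1 := by
      have := EuclideanSpace.real_norm_sq_eq v
      rw [hn] at this
      simp only [dotProduct, star_trivial]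
      rw [one_pow] at this
      rw [this]
      exact Finset.sum_congr rfl fun j _ => (sq _).symm
    rw [h5] at h4
    simpa using h4
  have h6 := sigmaMin_le S v hn
  have h7 : Matrix.toEuclideanLin S v = (η + sigmaMin S) • v := by
    apply WithLp.ofLp_injective
    rw [Matrix.ofLp_toLpLin]
    simpa using h2
  rw [h7, norm_smul, hn, mul_one, Real.norm_of_nonneg h3] at h6
  show 0 ≤ η
  linarith

theorem exists_factor {a : ℕ} (P : Matrix (Fin a) (Fin a) ℝ) (hP : P.PosSemidef) :
    ∃ C : Matrix (Fin a) (Fin a) ℝ, P = Cᵀ * C := by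
  open scoped MatrixOrder in
  obtain ⟨C, hC⟩ := CStarAlgebra.nonneg_iff_eq_star_mul_self.1 hP.nonneg
  exact ⟨C, by simpa [Matrix.star_eq_conjTranspose] using hC⟩

theorem trace_mul_nonneg {a : ℕ} (P S : Matrix (Fin a) (Fin a) ℝ) (hP : P.PosSemidef)
    (hS : S.PosSemidef) : 0 ≤ (P * S).trace := by
  obtain ⟨C, rfl⟩ := exists_factor P hP
  rw [Matrix.mul_assoc, Matrix.trace_mul_comm]
  have := (hS.mul_mul_conjTranspose_same C).trace_nonneg
  simpa using this

theorem sigmaMin_mul_trace_le {a : ℕ} (P S : Matrix (Fin a) (Fin a) ℝ) (hP : P.PosSemidef)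
    (hS : S.PosSemidef) : sigmaMin S * P.trace ≤ (P * S).trace := by
  have := trace_mul_nonneg P _ hP (psd_sub_sigmaMin S hS)
  rw [Matrix.mul_sub, Matrix.trace_sub, Matrix.mul_smul, Matrix.mul_one, Matrix.trace_smul,
    smul_eq_mul] at this
  linarith

attribute [local instance] Matrix.frobeniusNormedAddCommGroup in
theorem norm_le_trace {a : ℕ} (P : Matrix (Fin a) (Fin a) ℝ) (hP : P.PosSemidef)
    (x : EuclideanSpace ℝ (Fin a)) (hx : ‖x‖ ≤ 1) : ‖Matrix.toEuclideanLin P x‖ ≤ P.trace := by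
  obtain ⟨C, hC⟩ := exists_factor P hP
  have h1 : ‖P‖ ≤ P.trace := by
    have h2 : ‖C‖ * ‖C‖ = P.trace := by
      rw [Matrix.frobenius_norm_def, ← Real.sqrt_eq_rpow, Real.mul_self_sqrt (by positivity), hC,
        Matrix.trace, Finset.sum_comm]
      simp [Matrix.mul_apply, sq]
    have h3 := Matrix.frobenius_norm_mul Cᵀ C
    rw [Matrix.frobenius_norm_transpose, h2, ← hC] at h3
    exact h3
  have h4 := Matrix.frobenius_norm_mul P (Matrix.replicateCol Unit x.ofLp)
  rw [← Matrix.replicateCol_mulVec, Matrix.frobenius_norm_replicateCol,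
    Matrix.frobenius_norm_replicateCol] at h4
  have h5 : Matrix.toEuclideanLin P x = WithLp.toLp 2 (P *ᵥ x.ofLp) := by
    apply WithLp.ofLp_injective
    rw [Matrix.ofLp_toLpLin]
    simp
  rw [h5]
  refine h4.trans ?_
  calc ‖P‖ * ‖WithLp.toLp 2 x.ofLp‖ ≤ ‖P‖ * 1 :=
        mul_le_mul_of_nonneg_left hx (norm_nonneg _)
    _ ≤ P.trace := by rw [mul_one]; exact h1

theorem specNorm_le_trace {a : ℕ} (P : Matrix (Fin a) (Fin a) ℝ) (hP : P.PosSemidef) :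
    specNorm P ≤ P.trace := by
  have : Nonempty {x : EuclideanSpace ℝ (Fin a) // ‖x‖ ≤ 1} := ⟨⟨0, by simp⟩⟩
  exact ciSup_le fun x => norm_le_trace P hP x.1 x.2

end helpers

/-- trace bounds via the cost. -/
theorem trace_bounds_via_cost
    (d k N : ℕ) (hd : 0 < d) (hk : 0 < k) (hN : 0 < N)
    (A : Fin N → Matrix (Fin d) (Fin d) ℝ) (B : Fin N → Matrix (Fin d) (Fin k) ℝ)
    (Pr : Matrix (Fin N) (Fin N) ℝ)
    (hPr : ∀ i j, 0 ≤ Pr i j) (hPrSum : ∀ i, ∑ j, Pr i j = 1)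
    (piv : Fin N → ℝ) (hpiv : ∀ i, 0 < piv i) (hpivSum : ∑ i, piv i = 1)
    (Sg : Matrix (Fin d) (Fin d) ℝ) (hSg : Sg.PosDef)
    (Q : Fin N → Matrix (Fin d) (Fin d) ℝ) (hQ : ∀ i, (Q i).PosDef)
    (R : Fin N → Matrix (Fin k) (Fin k) ℝ) (hR : ∀ i, (R i).PosDef)
    (K : Fin N → Matrix (Fin k) (Fin d) ℝ) (hK : MSS Pr A B K) :
    cost Pr A B Q R piv Sg K = ∑ i, ((Q i + (K i)ᵀ * R i * K i) * XK Pr piv Sg (Gam A B K) i).trace ∧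
    ((⨆ i, specNorm (PK Pr A B Q R K i)) ≤ ∑ i, (PK Pr A B Q R K i).trace ∧
      ∑ i, (PK Pr A B Q R K i).trace ≤ cost Pr A B Q R piv Sg K / mu piv Sg) ∧
    ∑ i, (XK Pr piv Sg (Gam A B K) i).trace ≤ cost Pr A B Q R piv Sg K / lamMin Q := by
  haveI : Nonempty (Fin N) := ⟨⟨0, hN⟩⟩
  set Γ := Gam A B K with hΓ
  have hLs : ∀ V, Summable fun t : ℕ => (opL Pr Γ)^[t] V :=
    summable_iterate _ (summable_entry_pow _ hK) _ (tvec_opL Pr Γ)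
  have hTs : ∀ V, Summable fun t : ℕ => (opT Pr Γ)^[t] V := by
    refine summable_iterate _ (fun p q => ?_) _ (tvec_opT Pr Γ)
    simpa only [← Matrix.transpose_pow, Matrix.transpose_apply] using summable_entry_pow _ hK q p
  set W : Fin N → Matrix (Fin d) (Fin d) ℝ := fun i => Q i + (K i)ᵀ * R i * K i with hW
  have hKRK : ∀ i, ((K i)ᵀ * R i * K i).PosSemidef := fun i => by
    simpa using (hR i).posSemidef.conjTranspose_mul_mul_same (K i)
  have hWpsd : ∀ i, (W i).PosSemidef := fun i => (hQ i).posSemidef.add (hKRK i)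
  set P := PK Pr A B Q R K with hPdef
  have hPfix : P = W + opL Pr Γ P := by
    have hex : ∃ P, IsLyap Pr A B Q R K P := by
      obtain ⟨P, hP⟩ := exists_fix Pr Γ hLs W
      exact ⟨P, fun i => congrFun hP i⟩
    have hlyap : IsLyap Pr A B Q R K P := by
      rw [hPdef, PK, dif_pos hex]
      exact hex.choose_spec
    funext i
    exact hlyap i
  have hPsum := hasSum_of_fix Pr Γ hLs W P hPfix
  have hPpsd : ∀ i, (P i).PosSemidef :=
    psd_hasSum _ _ hPsum (fun t => psd_iterate _ (psd_opL Pr hPr Γ) W hWpsd t)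
  set X0 : Fin N → Matrix (Fin d) (Fin d) ℝ := fun i => piv i • Sg with hX0
  set X := XK Pr piv Sg Γ with hX
  have hXsum : HasSum (fun t : ℕ => (opT Pr Γ)^[t] X0) X := (hTs X0).hasSum
  have hXpsd : ∀ i, (X i).PosSemidef :=
    psd_hasSum _ _ hXsum (fun t => psd_iterate _ (psd_opT Pr hPr Γ) X0
      (fun i => hSg.posSemidef.smul (hpiv i).le) t)
  have hcost : cost Pr A B Q R piv Sg K = pair P X0 := by
    simp [cost, pair, hX0, ← hPdef]
  have hi : cost Pr A B Q R piv Sg K = pair W X := by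
    rw [hcost]
    have h1 := hPsum.map (pairL X0) (continuous_pair_left X0)
    have h2 := hXsum.map (pairR W) (continuous_pair_right W)
    have h3 : (⇑(pairL X0) ∘ fun t => (opL Pr Γ)^[t] W) =
        (⇑(pairR W) ∘ fun t => (opT Pr Γ)^[t] X0) := by
      funext t
      exact pair_iterate Pr Γ t W X0
    rw [h3] at h1
    exact h1.unique h2
  have hPtr : ∀ i, 0 ≤ (P i).trace := fun i => (hPpsd i).trace_nonneg
  have hXtr : ∀ i, 0 ≤ (X i).trace := fun i => (hXpsd i).trace_nonneg
  refine ⟨hi, ⟨?_, ?_⟩, ?_⟩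
  · refine ciSup_le fun i => (specNorm_le_trace _ (hPpsd i)).trans ?_
    exact Finset.single_le_sum (f := fun i => (P i).trace) (fun j _ => hPtr j) (Finset.mem_univ i)
  · have hs := sigmaMin_pos hd Sg hSg
    have hm : 0 < ⨅ i, piv i := by
      obtain ⟨i, hi⟩ := exists_eq_ciInf_of_finite (f := piv)
      rw [← hi]; exact hpiv i
    rw [mu, le_div_iff₀ (mul_pos hm hs), hcost, Finset.sum_mul]
    refine Finset.sum_le_sum fun i _ => ?_
    have h1 := sigmaMin_mul_trace_le (P i) Sg (hPpsd i) hSg.posSemidef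
    have h2 : (⨅ i, piv i) ≤ piv i := ciInf_le (Set.finite_range piv).bddBelow i
    have h3 : (P i * X0 i).trace = piv i * (P i * Sg).trace := by simp [hX0]
    rw [h3]
    calc (P i).trace * ((⨅ i, piv i) * sigmaMin Sg)
        = (⨅ i, piv i) * (sigmaMin Sg * (P i).trace) := by ring
      _ ≤ piv i * (sigmaMin Sg * (P i).trace) :=
          mul_le_mul_of_nonneg_right h2 (mul_nonneg hs.le (hPtr i))
      _ ≤ piv i * (P i * Sg).trace := mul_le_mul_of_nonneg_left h1 (hpiv i).le
  · have hl : 0 < lamMin Q := by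
      obtain ⟨i, hi⟩ := exists_eq_ciInf_of_finite (f := fun i => sigmaMin (Q i))
      rw [lamMin, ← hi]; exact sigmaMin_pos hd (Q i) (hQ i)
    rw [le_div_iff₀ hl, hi, Finset.sum_mul]
    refine Finset.sum_le_sum fun i _ => ?_
    have h1 := sigmaMin_mul_trace_le (X i) (Q i) (hXpsd i) (hQ i).posSemidef
    have h2 : lamMin Q ≤ sigmaMin (Q i) :=
      ciInf_le (f := fun i => sigmaMin (Q i)) (Set.finite_range _).bddBelow i
    have h3 := trace_mul_nonneg _ _ (hKRK i) (hXpsd i)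
    have h4 : (W i * X i).trace = (X i * Q i).trace + ((K i)ᵀ * R i * K i * X i).trace := by
      rw [hW, Matrix.add_mul, Matrix.trace_add, Matrix.trace_mul_comm (Q i)]
    rw [h4]
    have h5 := mul_le_mul_of_nonneg_right h2 (hXtr i)
    linarith [mul_comm (X i).trace (lamMin Q)]

end MJLS
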